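/- For every positive integer r, there exists n_0 such that for all n ≥ n_0, the path-chromatic number of the graph H_n of V's and Y's in the complete binary tree T_n is greater than r. In particular, the family {H_n} has tree-chromatic number at most 2 but unbounded path-chromatic number. -/

import Mathlib

open SimpleGraph

/-- A tree-decomposition of `G` with host graph `T`. -/
structure TreeDecomp {V : Type*} (G : SimpleGraph V) {ι : Type*} (T : SimpleGraph ι) where
  bag : ι → Set V
  covers_vertex : ∀ v, ∃ t, v ∈ bag t
  covers_edge : ∀ ⦃u v⦄, G.Adj u v → ∃ t, u ∈ bag t ∧ v ∈ bag t
  bags_connected : ∀ v, (T.induce {t | v ∈ bag t}).Connected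

/-- The chromatic number of a decomposition: sup over bags of the chromatic
number of the induced subgraph on the bag. -/
noncomputable def TreeDecomp.chi {V ι : Type*} {G : SimpleGraph V} {T : SimpleGraph ι}
    (D : TreeDecomp G T) : ℕ∞ :=
  ⨆ t, (G.induce (D.bag t)).chromaticNumber

/-- The tree-chromatic number of `G`. -/
noncomputable def treeChi {V : Type*} (G : SimpleGraph V) : ℕ∞ :=
  sInf {k | ∃ (ι : Type) (T : SimpleGraph ι), T.IsTree ∧ ∃ D : TreeDecomp G T, D.chi = k}

/-- The one-way infinite path on ℕ. -/
def pathGraphN : SimpleGraph ℕ := SimpleGraph.fromRel (fun i j => j = i + 1)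

/-- The path-chromatic number of `G`. -/
noncomputable def pathChi {V : Type*} (G : SimpleGraph V) : ℕ∞ :=
  sInf {k | ∃ D : TreeDecomp G pathGraphN, D.chi = k}

/-- `y` lies in the left tree above `x`: the first bit of `y` after the
initial segment `x` is `0`. -/
def leftAbove (x y : List Bool) : Prop := ∃ t, y = x ++ false :: t

/-- `y` lies in the right tree above `x`: the first bit of `y` after the
initial segment `x` is `1`. -/
def rightAbove (x y : List Bool) : Prop := ∃ t, y = x ++ true :: t

/-- A "V" in the complete binary tree `T n` (binary strings of length at most `n`):
a low point `x` with `y` in the left tree above `x` and `z` in the right tree above `x`. -/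
structure Vee (n : ℕ) where
  x : List Bool
  y : List Bool
  z : List Bool
  hx : x.length ≤ n
  hy : y.length ≤ n
  hz : z.length ≤ n
  hxy : leftAbove x y
  hxz : rightAbove x z

/-- The graph `G n` of V's: two V's are adjacent iff an endpoint (`y` or `z`)
of one is the low point `x` of the other. -/
def GraphV (n : ℕ) : SimpleGraph (Vee n) :=
  SimpleGraph.fromRel (fun V₁ V₂ => V₁.z = V₂.x ∨ V₁.y = V₂.x)

/-- A "Y" in `T n`: a lowest leaf `b`, a branch point `x` strictly above `b`,
and upper leaves `y` (left) and `z` (right) above `x`. -/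
structure Wye (n : ℕ) where
  b : List Bool
  x : List Bool
  y : List Bool
  z : List Bool
  hb : b.length ≤ n
  hx : x.length ≤ n
  hy : y.length ≤ n
  hz : z.length ≤ n
  hbx : b <+: x
  hbxne : b ≠ x
  hxy : leftAbove x y
  hxz : rightAbove x z

/-- Adjacency relation for `H n`: an upper leaf of one element equals the
low point / lowest leaf of the other. -/
def relH (n : ℕ) : (Vee n ⊕ Wye n) → (Vee n ⊕ Wye n) → Prop
  | Sum.inl V₁, Sum.inl V₂ => V₁.z = V₂.x ∨ V₁.y = V₂.x
  | Sum.inr Y₁, Sum.inr Y₂ => Y₁.y = Y₂.b ∨ Y₁.z = Y₂.b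
  | Sum.inr Y, Sum.inl V => Y.y = V.x ∨ Y.z = V.x
  | Sum.inl _, Sum.inr _ => False

/-- The graph `H n` of V's and Y's in `T n`. -/
def GraphH (n : ℕ) : SimpleGraph (Vee n ⊕ Wye n) := SimpleGraph.fromRel (relH n)


namespace VY

/-! ### Tree-chromatic number at most two -/

/-- The lowest point of a V or a Y. -/
def low {n : ℕ} : Vee n ⊕ Wye n → List Bool
  | Sum.inl V => V.x
  | Sum.inr Y => Y.b

/-- The left upper leaf. -/
def upL {n : ℕ} : Vee n ⊕ Wye n → List Bool
  | Sum.inl V => V.y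
  | Sum.inr Y => Y.y

/-- The right upper leaf. -/
def upR {n : ℕ} : Vee n ⊕ Wye n → List Bool
  | Sum.inl V => V.z
  | Sum.inr Y => Y.z

/-- The branch point. -/
def br {n : ℕ} : Vee n ⊕ Wye n → List Bool
  | Sum.inl V => V.x
  | Sum.inr Y => Y.x

lemma low_br {n : ℕ} (a : Vee n ⊕ Wye n) : low a <+: br a := by
  rcases a with V | Y
  · exact List.prefix_rfl
  · exact Y.hbx

lemma br_upL {n : ℕ} (a : Vee n ⊕ Wye n) : br a ++ [false] <+: upL a := by
  rcases a with V | Y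
  · obtain ⟨t, ht⟩ := V.hxy
    exact ⟨t, by simp [br, upL, ht]⟩
  · obtain ⟨t, ht⟩ := Y.hxy
    exact ⟨t, by simp [br, upL, ht]⟩

lemma br_upR {n : ℕ} (a : Vee n ⊕ Wye n) : br a ++ [true] <+: upR a := by
  rcases a with V | Y
  · obtain ⟨t, ht⟩ := V.hxz
    exact ⟨t, by simp [br, upR, ht]⟩
  · obtain ⟨t, ht⟩ := Y.hxz
    exact ⟨t, by simp [br, upR, ht]⟩

lemma diverge {x t : List Bool} (h1 : x ++ [false] <+: t) (h2 : x ++ [true] <+: t) : False := by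
  obtain ⟨a, rfl⟩ := h1
  obtain ⟨b, hb⟩ := h2
  simp at hb

lemma low_lt_upL {n : ℕ} (a : Vee n ⊕ Wye n) : (low a).length < (upL a).length := by
  have h1 := (low_br a).length_le
  have h2 := (br_upL a).length_le
  simp at h2; omega

lemma low_lt_upR {n : ℕ} (a : Vee n ⊕ Wye n) : (low a).length < (upR a).length := by
  have h1 := (low_br a).length_le
  have h2 := (br_upR a).length_le
  simp at h2; omega

lemma low_upL {n : ℕ} (a : Vee n ⊕ Wye n) : low a <+: upL a :=
  (low_br a).trans ((List.prefix_append _ _).trans (br_upL a))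

lemma low_upR {n : ℕ} (a : Vee n ⊕ Wye n) : low a <+: upR a :=
  (low_br a).trans ((List.prefix_append _ _).trans (br_upR a))

lemma relH_imp {n : ℕ} {a b : Vee n ⊕ Wye n} (h : relH n a b) :
    upL a = low b ∨ upR a = low b := by
  rcases a with V | Y <;> rcases b with V' | Y' <;> simp only [relH] at h <;>
    simp only [upL, upR, low] <;> tauto

/-- The infinite binary tree. -/
def btree : SimpleGraph (List Bool) := SimpleGraph.fromRel (fun a b => ∃ c, b = a ++ [c])

lemma btree_adj {a b : List Bool} :
    btree.Adj a b ↔ (∃ c, b = a ++ [c]) ∨ (∃ c, a = b ++ [c]) := by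
  rw [btree, SimpleGraph.fromRel_adj]
  constructor
  · rintro ⟨_, h⟩; exact h
  · intro h
    refine ⟨?_, h⟩
    rintro rfl
    rcases h with ⟨c, h⟩ | ⟨c, h⟩ <;> simp at h

/-- The bag of `t`. -/
def tbag (n : ℕ) (t : List Bool) : Set (Vee n ⊕ Wye n) :=
  {a | low a <+: t ∧ (t <+: upL a ∨ t <+: upR a)}

lemma bag_conn {S : Set (List Bool)} {l : List Bool} (hl : l ∈ S)
    (hS : ∀ t ∈ S, l <+: t) (hd : ∀ t c, l <+: t → t ++ [c] ∈ S → t ∈ S) :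
    (btree.induce S).Connected := by
  have key : ∀ s : List Bool, ∀ h : l ++ s ∈ S, (btree.induce S).Reachable ⟨l, hl⟩ ⟨l ++ s, h⟩ := by
    intro s
    induction s using List.reverseRecOn with
    | nil => 
      intro h
      have : (⟨l, hl⟩ : S) = ⟨l ++ [], h⟩ := by simp
      rw [this]
    | append_singleton s c ih =>
      intro h
      have h' : l ++ s ∈ S := hd (l ++ s) c (List.prefix_append _ _) (by simpa using h)
      refine (ih h').trans (SimpleGraph.Adj.reachable ?_)
      rw [SimpleGraph.induce_adj, btree_adj]
      exact Or.inl ⟨c, by simp⟩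
  rw [SimpleGraph.connected_iff_exists_forall_reachable]
  refine ⟨⟨l, hl⟩, ?_⟩
  rintro ⟨t, ht⟩
  obtain ⟨s, rfl⟩ := hS t ht
  exact key s ht

lemma btree_connected : btree.Connected := by
  have key : ∀ s : List Bool, btree.Reachable [] s := by
    intro s
    induction s using List.reverseRecOn with
    | nil => exact SimpleGraph.Reachable.refl _
    | append_singleton s c ih =>
      refine ih.trans (SimpleGraph.Adj.reachable ?_)
      rw [btree_adj]
      exact Or.inl ⟨c, rfl⟩
  rw [SimpleGraph.connected_iff_exists_forall_reachable]
  exact ⟨[], key⟩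

lemma reach_inv {V : Type*} {G : SimpleGraph V} (P : V → Prop)
    (h : ∀ a b, G.Adj a b → P a → P b) {a b : V} (hr : G.Reachable a b) (ha : P a) : P b := by
  obtain ⟨w⟩ := hr
  induction w with
  | nil => exact ha
  | cons hadj _ ih => exact ih (h _ _ hadj ha)

lemma bridge_aux (a : List Bool) (c : Bool) :
    ¬ (btree.deleteEdges {s(a, a ++ [c])}).Reachable (a ++ [c]) a := by
  intro hr
  have := reach_inv (fun t => a ++ [c] <+: t) ?_ hr List.prefix_rfl
  · have := this.length_le
    simp at this
  · intro u v huv hu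
    rw [SimpleGraph.deleteEdges_adj, btree_adj] at huv
    obtain ⟨huv, hne⟩ := huv
    rcases huv with ⟨d, rfl⟩ | ⟨d, rfl⟩
    · exact hu.trans (List.prefix_append _ _)
    · rw [List.prefix_concat_iff] at hu
      rcases hu with hu | hu
      · exfalso
        apply hne
        rw [← hu]
        have := List.append_inj' hu rfl
        simp [this.1, Sym2.eq_swap]
      · exact hu

lemma btree_isTree : btree.IsTree := by
  refine ⟨btree_connected, ?_⟩
  rw [SimpleGraph.isAcyclic_iff_forall_adj_isBridge]
  intro v w hvw
  rw [SimpleGraph.isBridge_iff]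
  rw [btree_adj] at hvw
  rcases hvw with ⟨c, rfl⟩ | ⟨c, rfl⟩
  · intro h
    exact bridge_aux v c h.symm
  · intro h
    rw [Sym2.eq_swap] at h
    exact bridge_aux w c h

/-- The tree-decomposition of `H n`. -/
def tdec (n : ℕ) : TreeDecomp (GraphH n) btree where
  bag := tbag n
  covers_vertex a := ⟨low a, List.prefix_rfl, Or.inl (low_upL a)⟩
  covers_edge := by
    have key : ∀ a b : Vee n ⊕ Wye n, relH n a b → ∃ t, a ∈ tbag n t ∧ b ∈ tbag n t := by
      intro a b h
      refine ⟨low b, ⟨?_, ?_⟩, List.prefix_rfl, Or.inl (low_upL b)⟩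
      · rcases relH_imp h with h | h <;> rw [← h]
        · exact low_upL a
        · exact low_upR a
      · rcases relH_imp h with h | h <;> rw [← h]
        · exact Or.inl List.prefix_rfl
        · exact Or.inr List.prefix_rfl
    intro a b h
    rw [GraphH, SimpleGraph.fromRel_adj] at h
    rcases h.2 with h | h
    · exact key a b h
    · obtain ⟨t, h1, h2⟩ := key b a h
      exact ⟨t, h2, h1⟩
  bags_connected a := by
    refine bag_conn (l := low a) ⟨List.prefix_rfl, Or.inl (low_upL a)⟩ (fun t ht => ht.1) ?_
    intro t c hl ht
    refine ⟨hl, ?_⟩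
    rcases ht.2 with h | h
    · exact Or.inl ((List.prefix_append _ _).trans h)
    · exact Or.inr ((List.prefix_append _ _).trans h)

lemma rel_bag {n : ℕ} {a b : Vee n ⊕ Wye n} {t : List Bool} (h : relH n a b)
    (ha : a ∈ tbag n t) (hb : b ∈ tbag n t) : low b = t ∧ low a ≠ t := by
  have hlow : low b = t := by
    rcases relH_imp h with h | h <;> rcases ha.2 with h' | h'
    · have := hb.1
      rw [← h] at this ⊢
      exact this.eq_of_length_le h'.length_le
    · exfalso
      have := hb.1
      rw [← h] at this
      exact diverge ((br_upL a).trans (this.trans h')) (br_upR a)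
    · exfalso
      have := hb.1
      rw [← h] at this
      exact diverge (br_upL a) ((br_upR a).trans (this.trans h'))
    · have := hb.1
      rw [← h] at this ⊢
      exact this.eq_of_length_le h'.length_le
  refine ⟨hlow, ?_⟩
  intro h2
  have h3 := low_lt_upL a
  have h4 := low_lt_upR a
  rw [h2] at h3 h4
  rcases relH_imp h with h | h <;> rw [hlow] at h
  · rw [h] at h3; omega
  · rw [h] at h4; omega

lemma treeChi_le (n : ℕ) : treeChi (GraphH n) ≤ 2 := by
  have h0 : treeChi (GraphH n) ≤ (tdec n).chi :=
    sInf_le ⟨List Bool, btree, btree_isTree, tdec n, rfl⟩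
  refine h0.trans ?_
  refine iSup_le fun t => ?_
  have hc : ((GraphH n).induce ((tdec n).bag t)).Colorable 2 := by
    classical
    refine ⟨SimpleGraph.Coloring.mk (fun a => if low a.1 = t then (1 : Fin 2) else 0) ?_⟩
    rintro ⟨a, ha⟩ ⟨b, hb⟩ hab
    have hab : (GraphH n).Adj a b := hab
    rw [GraphH, SimpleGraph.fromRel_adj] at hab
    rcases hab.2 with h | h
    · obtain ⟨h1, h2⟩ := rel_bag h ha hb
      simp [h1, h2]
    · obtain ⟨h1, h2⟩ := rel_bag h hb ha
      simp [h1, h2]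
  exact_mod_cast hc.chromaticNumber_le

/-! ### Path-chromatic number -/

lemma bag_convex {n : ℕ} (D : TreeDecomp (GraphH n) pathGraphN) {a : Vee n ⊕ Wye n} {i q j : ℕ}
    (hi : a ∈ D.bag i) (hj : a ∈ D.bag j) (hiq : i ≤ q) (hqj : q ≤ j) : a ∈ D.bag q := by
  by_contra hq
  have hr := (D.bags_connected a).preconnected ⟨i, hi⟩ ⟨j, hj⟩
  have := reach_inv (fun t => t.1 < q) ?_ hr (lt_of_le_of_ne hiq (by rintro rfl; exact hq hi))
  · simp at this; omega
  · rintro ⟨u, hu⟩ ⟨v, hv⟩ huv h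
    have huv : pathGraphN.Adj u v := huv
    unfold pathGraphN at huv
    rw [SimpleGraph.fromRel_adj] at huv
    have hne : v ≠ q := by rintro rfl; exact hq hv
    simp at huv h ⊢
    omega

/-- All Y's with upper leaf `u` have a bag at or before `q`. -/
def PL {n : ℕ} (D : TreeDecomp (GraphH n) pathGraphN) (q : ℕ) (u : List Bool) : Prop :=
  ∀ W : Wye n, (W.y = u ∨ W.z = u) → ∃ i, i ≤ q ∧ Sum.inr W ∈ D.bag i

/-- All Y's with upper leaf `u` have a bag at or after `q`. -/
def PR {n : ℕ} (D : TreeDecomp (GraphH n) pathGraphN) (q : ℕ) (u : List Bool) : Prop :=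
  ∀ W : Wye n, (W.y = u ∨ W.z = u) → ∃ i, q ≤ i ∧ Sum.inr W ∈ D.bag i

/-- All Y's with lowest leaf `u` are in bag `q`. -/
def PC {n : ℕ} (D : TreeDecomp (GraphH n) pathGraphN) (q : ℕ) (u : List Bool) : Prop :=
  ∀ W : Wye n, W.b = u → Sum.inr W ∈ D.bag q

lemma wye_lt {n : ℕ} (W : Wye n) : W.b.length < W.y.length ∧ W.b.length < W.z.length :=
  ⟨low_lt_upL (Sum.inr W), low_lt_upR (Sum.inr W)⟩

lemma wye_adj {n : ℕ} {W W' : Wye n} (h : W.y = W'.b ∨ W.z = W'.b) :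
    (GraphH n).Adj (Sum.inr W) (Sum.inr W') := by
  rw [GraphH, SimpleGraph.fromRel_adj]
  refine ⟨?_, Or.inl h⟩
  intro he
  obtain rfl : W = W' := by simpa using he
  have := wye_lt W
  rcases h with h | h <;> rw [h] at this <;> omega

lemma trich {n : ℕ} (D : TreeDecomp (GraphH n) pathGraphN) (q : ℕ) (u : List Bool)
    (hL : ¬ PL D q u) (hR : ¬ PR D (q + 1) u) : PC D q u := by
  intro W' hW'
  simp only [PL, PR, not_forall, not_exists, not_and] at hL hR
  obtain ⟨W1, h1, hW1⟩ := hL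
  obtain ⟨W2, h2, hW2⟩ := hR
  rw [← hW'] at h1 h2
  obtain ⟨i, hi1, hi⟩ := D.covers_edge (wye_adj h1)
  obtain ⟨j, hj1, hj⟩ := D.covers_edge (wye_adj h2)
  have hqi : q < i := by
    by_contra hc
    exact hW1 i (by omega) hi1
  have hjq : j ≤ q := by
    by_contra hc
    exact hW2 j (by omega) hj1
  exact bag_convex D hj hi hjq hqi.le

lemma shift {n r : ℕ} (D : TreeDecomp (GraphH n) pathGraphN) (q : ℕ)
    (hq : ((GraphH n).induce (D.bag q)).Colorable r) (I : Finset ℕ) (x : ℕ → List Bool)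
    (hx : ∀ i ∈ I, ∀ j ∈ I, i < j → ∃ W : Wye n, Sum.inr W ∈ D.bag q ∧ W.b = x i ∧
      (W.y = x j ∨ W.z = x j)) : I.card ≤ 2 ^ r := by
  classical
  obtain ⟨C⟩ := hq
  let F : ℕ → Finset (Fin r) := fun i =>
    Finset.univ.filter (fun c => ∃ (W : Wye n) (h : Sum.inr W ∈ D.bag q), W.b = x i ∧ C ⟨_, h⟩ = c)
  have hF : ∀ i ∈ I, ∀ j ∈ I, i < j → F i ≠ F j := by
    intro i hi j hj hij he
    obtain ⟨W, hW, hb, hl⟩ := hx i hi j hj hij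
    have h1 : C ⟨_, hW⟩ ∈ F i := by
      simp only [F, Finset.mem_filter, Finset.mem_univ, true_and]
      exact ⟨W, hW, hb, rfl⟩
    rw [he] at h1
    simp only [F, Finset.mem_filter, Finset.mem_univ, true_and] at h1
    obtain ⟨W', hW', hb', hc⟩ := h1
    rw [← hb'] at hl
    have hadj : ((GraphH n).induce (D.bag q)).Adj ⟨_, hW⟩ ⟨_, hW'⟩ := wye_adj hl
    exact C.valid hadj hc.symm
  have := Finset.card_le_card_of_injOn (s := I) (t := Finset.univ) F (by simp) (by
    intro i hi j hj he
    rcases lt_trichotomy i j with h | h | h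
    · exact absurd he (hF i hi j hj h)
    · exact h
    · exact absurd he.symm (hF j hj i hi h))
  simpa using this

/-- Building a Y. -/
lemma mkY {n : ℕ} {b w v z : List Bool} {c : Bool} (hbw : b <+: w) (hne : b ≠ w)
    (hv : w ++ [c] <+: v) (hz : w ++ [!c] <+: z) (hvn : v.length ≤ n) (hzn : z.length ≤ n) :
    ∃ W : Wye n, W.b = b ∧ ((W.y = v ∧ W.z = z) ∨ (W.z = v ∧ W.y = z)) := by
  have h1 := hbw.length_le
  have h2 := hv.length_le
  simp at h2
  obtain ⟨s, hs⟩ := hv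
  obtain ⟨t, ht⟩ := hz
  cases c
  · exact ⟨⟨b, w, v, z, by omega, by omega, hvn, hzn, hbw, hne, ⟨s, by simp [← hs]⟩,
      ⟨t, by simp [← ht]⟩⟩, rfl, Or.inl ⟨rfl, rfl⟩⟩
  · exact ⟨⟨b, w, z, v, by omega, by omega, hzn, hvn, hbw, hne, ⟨t, by simp [← ht]⟩,
      ⟨s, by simp [← hs]⟩⟩, rfl, Or.inr ⟨rfl, rfl⟩⟩

/-- The part of the tree above `u ++ [false]` considered for extremal nodes. -/
def TT (n : ℕ) (u : List Bool) : Set (List Bool) :=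
  {v | u ++ [false] <+: v ∧ u.length + 3 ≤ v.length ∧ v.length ≤ n}

lemma TT_finite (n : ℕ) (u : List Bool) : (TT n u).Finite :=
  (List.finite_length_le Bool n).subset fun _ hv => hv.2.2

lemma TT_nonempty {n : ℕ} {u : List Bool} (h : u.length + 3 ≤ n) : (TT n u).Nonempty :=
  ⟨u ++ [false, false, false], ⟨[false, false], by simp⟩, by simp, by simpa using h⟩

lemma exists_best {T : Set (List Bool)} (hT : T.Finite) (hne : T.Nonempty)
    (P : ℕ → List Bool → Prop)
    (htot : ∀ u v, {q | P q u} ⊆ {q | P q v} ∨ {q | P q v} ⊆ {q | P q u}) :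
    ∃ α ∈ T, ∀ u ∈ T, ∀ q, P q u → P q α := by
  obtain ⟨α, hα, hmax⟩ := hT.exists_maximalFor (fun u => {q | P q u}) T hne
  refine ⟨α, hα, fun u hu q hq => ?_⟩
  rcases htot u α with h | h
  · exact h hq
  · exact hmax hu h hq

lemma bestL {n : ℕ} (D : TreeDecomp (GraphH n) pathGraphN) {u : List Bool}
    (hu : u.length + 3 ≤ n) :
    ∃ α ∈ TT n u, ∀ v ∈ TT n u, ∀ q, PL D q v → PL D q α := by
  refine exists_best (TT_finite n u) (TT_nonempty hu) (PL D) fun u v => ?_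
  have hup : ∀ u, IsUpperSet {q | PL D q u} := by
    intro u a b hab ha W hW
    obtain ⟨i, hi, h⟩ := ha W hW
    exact ⟨i, hi.trans hab, h⟩
  exact (hup u).total (hup v)

lemma bestR {n : ℕ} (D : TreeDecomp (GraphH n) pathGraphN) {u : List Bool}
    (hu : u.length + 3 ≤ n) :
    ∃ β ∈ TT n u, ∀ v ∈ TT n u, ∀ q, PR D q v → PR D q β := by
  refine exists_best (TT_finite n u) (TT_nonempty hu) (PR D) fun u v => ?_
  have hup : ∀ u, IsLowerSet {q | PR D q u} := by
    intro u a b hab ha W hW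
    obtain ⟨i, hi, h⟩ := ha W hW
    exact ⟨i, hab.trans hi, h⟩
  exact (hup u).total (hup v)

/-- Some grandchild of `w` avoids two given nodes. -/
lemma avoid (w α β : List Bool) : ∃ a b : Bool, ¬ w ++ [a, b] <+: α ∧ ¬ w ++ [a, b] <+: β := by
  have key : ∀ (γ : List Bool) (a b a' b' : Bool), w ++ [a, b] <+: γ → w ++ [a', b'] <+: γ →
      a = a' ∧ b = b' := by
    rintro γ a b a' b' ⟨s, hs⟩ ⟨t, rfl⟩
    simp at hs
    exact ⟨hs.1, hs.2.1⟩
  by_contra hcon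
  push Not at hcon
  have h1 := hcon false false
  have h2 := hcon false true
  have h3 := hcon true false
  have k1 := key α false false false true
  have k2 := key α false false true false
  have k3 := key α false true true false
  have k4 := key β false false false true
  have k5 := key β false false true false
  have k6 := key β false true true false
  simp only [reduceCtorEq, and_false, false_and, imp_false] at k1 k2 k3 k4 k5 k6
  tauto

/-- A node off the path branches off strictly above `u`. -/
lemma branch {n : ℕ} {u v z : List Bool} {a b : Bool} (hz : z ∈ TT n u)
    (hav : ¬ u ++ [false] ++ [a, b] <+: z) (hv : u ++ [false] ++ [a, b] <+: v)
    (hvn : v.length ≤ n) :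
    ∃ W : Wye n, W.b = u ∧ ((W.y = v ∧ W.z = z) ∨ (W.z = v ∧ W.y = z)) := by
  obtain ⟨⟨s, rfl⟩, h2, h3⟩ := hz
  obtain ⟨t, rfl⟩ := hv
  match s, h2, h3, hav with
  | [], h2, _, _ => simp at h2
  | [_], h2, _, _ => simp at h2
  | c :: d :: s, h2, h3, hav =>
    by_cases hca : c = a
    · subst hca
      have hdb : d = !b := by
        by_contra hne
        apply hav
        have : d = b := by cases d <;> cases b <;> simp_all
        subst this
        exact ⟨s, by simp⟩
      subst hdb
      exact mkY (w := u ++ [false, c]) (c := b) (List.prefix_append _ _) (by simp)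
        ⟨t, by simp⟩ ⟨s, by simp⟩ hvn h3
    · have hca : c = !a := by cases c <;> cases a <;> simp_all
      subst hca
      exact mkY (w := u ++ [false]) (c := a) (List.prefix_append _ _) (by simp)
        ⟨b :: t, by simp⟩ ⟨d :: s, by simp⟩ hvn h3

lemma memq {n : ℕ} (D : TreeDecomp (GraphH n) pathGraphN) {q : ℕ} {W : Wye n} {v z : List Bool}
    (hW : (W.y = v ∧ W.z = z) ∨ (W.z = v ∧ W.y = z)) (hv : PL D q v) (hz : PR D q z) :
    Sum.inr W ∈ D.bag q := by
  obtain ⟨i, hi, h1⟩ := hv W (by tauto)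
  obtain ⟨j, hj, h2⟩ := hz W (by tauto)
  exact bag_convex D h1 h2 hi hj

/-- The chain of nodes. -/
lemma chain {n : ℕ} (D : TreeDecomp (GraphH n) pathGraphN) (K : ℕ) (hK : 3 * K ≤ n) :
    ∃ u : ℕ → List Bool, (∀ i ≤ K, (u i).length = 3 * i) ∧ ∀ i < K, ∃ a b : Bool, ∃ α ∈ TT n (u i),
      ∃ β ∈ TT n (u i), u (i + 1) = u i ++ [false] ++ [a, b] ∧ ¬ u (i + 1) <+: α ∧
        ¬ u (i + 1) <+: β ∧ (∀ v ∈ TT n (u i), ∀ q, PL D q v → PL D q α) ∧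
        (∀ v ∈ TT n (u i), ∀ q, PR D q v → PR D q β) := by
  have step : ∀ u : List Bool, ∃ u' : List Bool, u'.length = u.length + 3 ∧
      (u.length + 3 ≤ n → ∃ a b : Bool, ∃ α ∈ TT n u,
      ∃ β ∈ TT n u, u' = u ++ [false] ++ [a, b] ∧ ¬ u' <+: α ∧
        ¬ u' <+: β ∧ (∀ v ∈ TT n u, ∀ q, PL D q v → PL D q α) ∧
        (∀ v ∈ TT n u, ∀ q, PR D q v → PR D q β)) := by
    intro u
    by_cases hu : u.length + 3 ≤ n
    · obtain ⟨α, hα, hα'⟩ := bestL D hu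
      obtain ⟨β, hβ, hβ'⟩ := bestR D hu
      obtain ⟨a, b, h1, h2⟩ := avoid (u ++ [false]) α β
      exact ⟨u ++ [false] ++ [a, b], by simp, fun _ =>
        ⟨a, b, α, hα, β, hβ, rfl, h1, h2, hα', hβ'⟩⟩
    · exact ⟨u ++ [false, false, false], by simp, fun h => absurd h hu⟩
  choose f hf hf' using step
  have hlen : ∀ i, (f^[i] []).length = 3 * i := by
    intro i
    induction i with
    | zero => simp
    | succ i ih => rw [Function.iterate_succ_apply', hf, ih]; ring
  refine ⟨fun i => f^[i] [], fun i _ => hlen i, fun i hi => ?_⟩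
  have := hf' (f^[i] []) (by rw [hlen]; omega)
  simpa only [Function.iterate_succ_apply'] using this

lemma main {n r K N : ℕ} (D : TreeDecomp (GraphH n) pathGraphN)
    (hcol : ∀ q, ((GraphH n).induce (D.bag q)).Colorable r)
    (hN : 2 ^ r < N) (hKN : 3 * N ≤ K) (hn : 3 * K + 3 + 2 * N ≤ n) : False := by
  classical
  obtain ⟨u, hlen, hu⟩ := chain D K (by omega)
  -- prefix relations
  have hstep : ∀ i < K, u i ++ [false] <+: u (i + 1) := by
    intro i hi
    obtain ⟨a, b, _, _, _, _, h, _⟩ := hu i hi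
    rw [h]; exact List.prefix_append _ _
  have hmono : ∀ i j, i ≤ j → j ≤ K → u i <+: u j := by
    intro i j hij
    induction j, hij using Nat.le_induction with
    | base => intro _; exact List.prefix_rfl
    | succ j _ ih =>
      intro hj
      exact (ih (by omega)).trans ((List.prefix_append _ _).trans (hstep j (by omega)))
  have hTT : ∀ i ≤ K, TT n (u K) ⊆ TT n (u i) := by
    intro i hi v hv
    rcases Nat.lt_or_eq_of_le hi with h | rfl
    · refine ⟨((hstep i h).trans (hmono (i + 1) K h le_rfl)).trans
        ((List.prefix_append _ _).trans hv.1), ?_, hv.2.2⟩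
      have := hv.2.1
      rw [hlen K le_rfl] at this
      rw [hlen i hi]; omega
    · exact hv
  have hKlen := hlen K le_rfl
  -- case where everything high up is of type C
  have caseC : ∀ q, (∀ v ∈ TT n (u K), PC D q v) → False := by
    intro q hC
    have hx : ∀ j < N, u K ++ List.replicate (2 * j + 3) false ∈ TT n (u K) := by
      intro j hj
      refine ⟨⟨List.replicate (2 * j + 2) false, ?_⟩, by simp, by simp; omega⟩
      rw [List.append_assoc]
      rfl
    have := shift D q (hcol q) (Finset.range N)
      (fun j => u K ++ List.replicate (2 * j + 3) false) ?_
    · simp at this; omega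
    · intro i hi j hj hij
      simp only [Finset.mem_range] at hi hj
      obtain ⟨W, hb, hW⟩ := mkY (n := n) (b := u K ++ List.replicate (2 * i + 3) false)
        (w := u K ++ List.replicate (2 * i + 3) false ++ [false])
        (v := u K ++ List.replicate (2 * j + 3) false)
        (z := u K ++ List.replicate (2 * i + 3) false ++ [false] ++ [true]) (c := false)
        (List.prefix_append _ _) (by simp)
        ⟨List.replicate (2 * (j - i) - 2) false, by
          have : 2 * j + 3 = (2 * i + 3) + (1 + (1 + (2 * (j - i) - 2))) := by omega
          rw [this]
          simp [List.replicate_add]⟩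
        (by simp) (hx j hj).2.2 (by simp; omega)
      exact ⟨W, hC _ (hx i hi) W hb, hb, by tauto⟩
  -- choice of q
  obtain ⟨q, ⟨α, hα, hαq⟩, ⟨β, hβ, hβq⟩⟩ : ∃ q, (∃ α ∈ TT n (u K), PL D q α) ∧
      (∃ β ∈ TT n (u K), PR D q β) := by
    by_contra hcon
    push Not at hcon
    by_cases hA : ∃ q, ∃ α ∈ TT n (u K), PL D q α
    · have h1 := Nat.find_spec hA
      have h2 := fun m => Nat.find_min hA (m := m)
      generalize Nat.find hA = a at h1 h2
      rcases a with _ | a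
      · obtain ⟨α, hα, h⟩ := h1
        refine hcon 0 ⟨α, hα, h⟩ α hα ?_
        intro W _
        obtain ⟨i, hi⟩ := D.covers_vertex (Sum.inr W)
        exact ⟨i, Nat.zero_le _, hi⟩
      · obtain ⟨α, hα, h⟩ := h1
        refine caseC a fun v hv => trich D a v ?_ (hcon _ ⟨α, hα, h⟩ v hv)
        intro hv'
        exact h2 a (by omega) ⟨v, hv, hv'⟩
    · have hfin : Finite (Wye n) := by
        have : Finite {l : List Bool // l.length ≤ n} := (List.finite_length_le Bool n).to_subtype
        refine Finite.of_injective (β := {l : List Bool // l.length ≤ n} ×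
          {l : List Bool // l.length ≤ n} × {l : List Bool // l.length ≤ n} ×
          {l : List Bool // l.length ≤ n})
          (fun W => (⟨W.b, W.hb⟩, ⟨W.x, W.hx⟩, ⟨W.y, W.hy⟩, ⟨W.z, W.hz⟩)) ?_
        rintro ⟨⟩ ⟨⟩ h
        simpa using h
      apply hA
      choose g hg using fun W : Wye n => D.covers_vertex (Sum.inr W)
      obtain ⟨M, hM⟩ := (Set.finite_range g).bddAbove
      obtain ⟨v, hv⟩ := TT_nonempty (n := n) (u := u K) (by omega)
      exact ⟨M, v, hv, fun W _ => ⟨g W, hM ⟨W, rfl⟩, hg W⟩⟩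
  -- the three types
  let IL := (Finset.range K).filter fun i => PL D q (u i)
  let IR := (Finset.range K).filter fun i => PR D q (u i)
  let IC := (Finset.range K).filter fun i => PC D q (u i)
  have hcov : Finset.range K ⊆ IL ∪ (IR ∪ IC) := by
    intro i hi
    simp only [IL, IR, IC, Finset.mem_union, Finset.mem_filter, hi, true_and]
    by_cases h1 : PL D q (u i)
    · exact Or.inl h1
    by_cases h2 : PR D q (u i)
    · exact Or.inr (Or.inl h2)
    refine Or.inr (Or.inr (trich D q _ h1 fun h => h2 fun W hW => ?_))
    obtain ⟨j, hj, h⟩ := h W hW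
    exact ⟨j, by omega, h⟩
  have hcard := (Finset.card_le_card hcov).trans ((Finset.card_union_le _ _).trans
    (Nat.add_le_add_left (Finset.card_union_le _ _) _))
  have key : ∀ i j, i < j → j < K → ∃ W : Wye n, ∃ z, PR D q z ∧ W.b = u i ∧
      ((W.y = u j ∧ W.z = z) ∨ (W.z = u j ∧ W.y = z)) := by
    intro i j hij hj
    obtain ⟨a, b, α', hα', β', hβ', h1, h2, h3, h4, h5⟩ := hu i (by omega)
    have hp := hmono (i + 1) j hij hj.le
    rw [h1] at h3 hp
    obtain ⟨W, hb, hW⟩ := branch hβ' h3 hp (by rw [hlen j hj.le]; omega)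
    exact ⟨W, β', h5 β (hTT i (by omega) hβ) q hβq, hb, hW⟩
  have key' : ∀ i j, i < j → j < K → ∃ W : Wye n, ∃ z, PL D q z ∧ W.b = u i ∧
      ((W.y = u j ∧ W.z = z) ∨ (W.z = u j ∧ W.y = z)) := by
    intro i j hij hj
    obtain ⟨a, b, α', hα', β', hβ', h1, h2, h3, h4, h5⟩ := hu i (by omega)
    have hp := hmono (i + 1) j hij hj.le
    rw [h1] at h2 hp
    obtain ⟨W, hb, hW⟩ := branch hα' h2 hp (by rw [hlen j hj.le]; omega)
    exact ⟨W, α', h4 α (hTT i (by omega) hα) q hαq, hb, hW⟩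
  have cL : IL.card ≤ 2 ^ r := by
    refine shift D q (hcol q) IL u fun i _ j hj hij => ?_
    simp only [IL, Finset.mem_filter, Finset.mem_range] at hj
    obtain ⟨W, z, hz, hb, hW⟩ := key i j hij hj.1
    exact ⟨W, memq D hW hj.2 hz, hb, by tauto⟩
  have cR : IR.card ≤ 2 ^ r := by
    refine shift D q (hcol q) IR u fun i _ j hj hij => ?_
    simp only [IR, Finset.mem_filter, Finset.mem_range] at hj
    obtain ⟨W, z, hz, hb, hW⟩ := key' i j hij hj.1
    exact ⟨W, memq D (v := z) (z := u j) (by tauto) hz hj.2, hb, by tauto⟩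
  have cC : IC.card ≤ 2 ^ r := by
    refine shift D q (hcol q) IC u fun i hi j hj hij => ?_
    simp only [IC, Finset.mem_filter, Finset.mem_range] at hi hj
    obtain ⟨W, z, hz, hb, hW⟩ := key i j hij hj.1
    exact ⟨W, hi.2 W hb, hb, by tauto⟩
  rw [Finset.card_range] at hcard
  omega

lemma pathChi_gt (r : ℕ) (n : ℕ) (hn : 11 * (2 ^ r + 1) + 3 ≤ n) :
    (r : ℕ∞) < pathChi (GraphH n) := by
  by_contra hcon
  rw [not_lt] at hcon
  have hlt : pathChi (GraphH n) < ((r + 1 : ℕ) : ℕ∞) :=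
    lt_of_le_of_lt hcon (by exact_mod_cast Nat.lt_succ_self r)
  obtain ⟨k, ⟨D, rfl⟩, hk⟩ := sInf_lt_iff.1 hlt
  have hD : D.chi ≤ (r : ℕ∞) := by
    push_cast at hk
    exact ENat.lt_natCast_add_one_iff.1 hk
  refine main (r := r) (K := 3 * (2 ^ r + 1)) (N := 2 ^ r + 1) D (fun q => ?_) (by omega)
    le_rfl (by omega)
  rw [← SimpleGraph.chromaticNumber_le_iff_colorable]
  exact (le_iSup (fun t => ((GraphH n).induce (D.bag t)).chromaticNumber) q).trans hD

end VY

theorem stmt6 :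
    (∀ r : ℕ, 1 ≤ r → ∃ n₀ : ℕ, ∀ n, n₀ ≤ n → (r : ℕ∞) < pathChi (GraphH n)) ∧
    (∀ n : ℕ, 1 ≤ n → treeChi (GraphH n) ≤ 2) :=
  ⟨fun r _ => ⟨11 * (2 ^ r + 1) + 3, fun n hn => VY.pathChi_gt r n hn⟩,
    fun n _ => VY.treeChi_le n⟩
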